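/- arXiv:1208.2113 — 9 statements merged into one kernel-verified Lean document; each statement's English description precedes it below -/
import Mathlib

section
/- Let a^1,…,a^n ∈ ℝ^d, let w be an ordered weight vector, and let b ∈ ℝ. For x ∈ ℝ^d let ρ_w(x) = −Σ_{i=1}^n w_i s_i(x), where s_1(x) ≥ … ≥ s_n(x) is the decreasing rearrangement of the numbers ⟨a^1,x⟩,…,⟨a^n,x⟩. Then ρ_w(x) ≤ −b holds if and only if ⟨a,x⟩ ≥ b for every a in the weighted-mean region D_w(a^1,…,a^n). (Equivalence of the empirical coherent distortion risk constraint with the uncertainty-set constraint over the WM region.) -/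
open scoped RealInnerProductSpace

/-- The weighted-mean (WM) region of points `a 1, …, a n` with weight vector `w`:
the convex hull of all weighted sums `∑ j, w j • a (π j)` over permutations `π`. -/
noncomputable def wmRegion {d n : ℕ} (w : Fin n → ℝ)
    (a : Fin n → EuclideanSpace ℝ (Fin d)) : Set (EuclideanSpace ℝ (Fin d)) :=
  convexHull ℝ {x | ∃ π : Equiv.Perm (Fin n), x = ∑ j, w j • a (π j)}

/-- The decreasing rearrangement of `y`: `decSort y i` is the `i`-th largest entry of `y`. -/
noncomputable def decSort {n : ℕ} (y : Fin n → ℝ) : Fin n → ℝ :=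
  fun i => y (Tuple.sort y i.rev)

theorem antitone_decSort {n : ℕ} (y : Fin n → ℝ) : Antitone (decSort y) :=
  fun _ _ hij => Tuple.monotone_sort y (Fin.rev_le_rev.mpr hij)

/-- Rearrangement inequality: pairing increasing weights with the decreasing rearrangement of `y`
minimizes the weighted sum over all orderings of `y`. -/
theorem sum_mul_decSort_le_sum_mul_perm {n : ℕ} {w : Fin n → ℝ} (hw : Monotone w)
    (y : Fin n → ℝ) (π : Equiv.Perm (Fin n)) :
    ∑ i, w i * decSort y i ≤ ∑ i, w i * y (π i) := by
  have h := (hw.antivary (antitone_decSort y)).sum_mul_le_sum_mul_comp_perm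
    (σ := π.trans ((Fin.revPerm.trans (Tuple.sort y)).symm))
  simpa [decSort] using h

theorem inner_sum_smul_left {d n : ℕ} (w : Fin n → ℝ) (c : Fin n → EuclideanSpace ℝ (Fin d))
    (x : EuclideanSpace ℝ (Fin d)) :
    ⟪∑ j, w j • c j, x⟫ = ∑ j, w j * ⟪c j, x⟫ := by
  simp [sum_inner, real_inner_smul_left]

/-- The empirical coherent distortion risk constraint `ρ_w(x) ≤ -b`, where
`ρ_w(x) = -∑ i, w i * s i` and `s` is the decreasing rearrangement of the projections
`⟪a i, x⟫`, holds iff `⟪a, x⟫ ≥ b` for every `a` in the weighted-mean region. -/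
theorem stmt0 {d n : ℕ} (w : Fin n → ℝ) (hw0 : ∀ j, 0 ≤ w j)
    (hw1 : ∑ j, w j = 1) (hword : Monotone w)
    (a : Fin n → EuclideanSpace ℝ (Fin d)) (b : ℝ)
    (x : EuclideanSpace ℝ (Fin d)) :
    (-∑ i, w i * decSort (fun k => ⟪a k, x⟫) i ≤ -b) ↔
      ∀ u ∈ wmRegion w a, ⟪u, x⟫ ≥ b := by
  rw [neg_le_neg_iff]
  constructor
  · intro hb u hu
    have hconv : Convex ℝ {u : EuclideanSpace ℝ (Fin d) | b ≤ ⟪u, x⟫} :=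
      convex_halfSpace_ge ⟨fun u v => inner_add_left u v x, fun c u => real_inner_smul_left u x c⟩ b
    refine convexHull_min ?_ hconv hu
    rintro _ ⟨π, rfl⟩
    rw [Set.mem_ofPred_eq, inner_sum_smul_left]
    exact hb.trans (sum_mul_decSort_le_sum_mul_perm hword _ π)
  · intro h
    have hb := h _ (subset_convexHull ℝ _ ⟨Fin.revPerm.trans (Tuple.sort fun k => ⟪a k, x⟫), rfl⟩)
    rw [inner_sum_smul_left] at hb
    exact hb
end

section
/- Let a^1,…,a^n ∈ ℝ^d and let w be an ordered weight vector. For every p ∈ ℝ^d, the support function of the weighted-mean region satisfies sup{ ⟨p,a⟩ : a ∈ D_w(a^1,…,a^n) } = Σ_{j=1}^n w_j t_j, where t_1 ≤ t_2 ≤ … ≤ t_n is the increasing rearrangement of the projections ⟨p,a^1⟩,…,⟨p,a^n⟩. -/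
open scoped RealInnerProductSpace Pointwise

/-- The increasing rearrangement of `y`: `incSort y j` is the `j`-th smallest entry of `y`. -/
noncomputable def incSort {n : ℕ} (y : Fin n → ℝ) : Fin n → ℝ :=
  fun j => y (Tuple.sort y j)

/-- By the rearrangement inequality, the increasing rearrangement maximizes the pairing with an
ordered weight vector among all permutations. -/
theorem sum_mul_comp_perm_le_sum_mul_incSort {n : ℕ} {w : Fin n → ℝ} (hw : Monotone w)
    (y : Fin n → ℝ) (π : Equiv.Perm (Fin n)) :
    ∑ j, w j * y (π j) ≤ ∑ j, w j * incSort y j := by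
  have hmono : Monotone (incSort y) := Tuple.monotone_sort y
  simpa [incSort] using
    (hw.monovary hmono).sum_mul_comp_perm_le_sum_mul (σ := π.trans (Tuple.sort y).symm)

/-- The increasing rearrangement of the projections gives the largest value of `⟪p, ·⟫` on the
weighted-mean region of an ordered weight vector. -/
theorem isGreatest_inner_image_wmRegion {d n : ℕ} {w : Fin n → ℝ} (hw : Monotone w)
    (a : Fin n → EuclideanSpace ℝ (Fin d)) (p : EuclideanSpace ℝ (Fin d)) :
    IsGreatest ((fun u => ⟪p, u⟫) '' wmRegion w a)
      (∑ j, w j * incSort (fun i => ⟪p, a i⟫) j) := by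
  refine ⟨⟨∑ j, w j • a (Tuple.sort (fun i => ⟪p, a i⟫) j),
    subset_convexHull ℝ _ ⟨_, rfl⟩, by simp [inner_sum, inner_smul_right, incSort]⟩, ?_⟩
  rintro _ ⟨u, hu, rfl⟩
  refine convexHull_min ?_ (convex_halfSpace_le (innerₛₗ ℝ p).isLinear _) hu
  rintro _ ⟨π, rfl⟩
  simpa [inner_sum, inner_smul_right] using
    sum_mul_comp_perm_le_sum_mul_incSort hw (fun i => ⟪p, a i⟫) π

/-- The support function of the weighted-mean region in direction `p` equals
`∑ j, w j * t j`, where `t` is the increasing rearrangement of the projections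
`⟪p, a i⟫`. -/
theorem stmt2 {d n : ℕ} (w : Fin n → ℝ) (hw0 : ∀ j, 0 ≤ w j)
    (hw1 : ∑ j, w j = 1) (hword : Monotone w)
    (a : Fin n → EuclideanSpace ℝ (Fin d)) (p : EuclideanSpace ℝ (Fin d)) :
    sSup ((fun u => ⟪p, u⟫) '' wmRegion w a) =
      ∑ j, w j * incSort (fun i => ⟪p, a i⟫) j := by
  exact (isGreatest_inner_image_wmRegion hword a p).csSup_eq
end

section
/- Let a^1,…,a^n ∈ ℝ^d, let w be an ordered weight vector with strictly increasing entries (w_1 < w_2 < … < w_n), and let p ∈ ℝ^d be such that the projections ⟨p,a^1⟩,…,⟨p,a^n⟩ are pairwise distinct. Let π_p be the (unique) permutation with ⟨p,a^{π_p(1)}⟩ < … < ⟨p,a^{π_p(n)}⟩. Then the point Σ_{j=1}^n w_j a^{π_p(j)} is the unique maximizer of the linear functional x ↦ ⟨p,x⟩ over D_w(a^1,…,a^n); in particular it is an extreme point of D_w(a^1,…,a^n). -/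
open scoped RealInnerProductSpace Pointwise

/-- If a linear functional on a set `s` is strictly below its value at `x` away from `x`,
then the same holds on the convex hull of `s`. -/
theorem eq_or_lt_of_mem_convexHull {E : Type*} [AddCommGroup E] [Module ℝ E] (f : E →ₗ[ℝ] ℝ)
    {s : Set E} {x : E} (hs : ∀ u ∈ s, u = x ∨ f u < f x) {u : E} (hu : u ∈ convexHull ℝ s) :
    u = x ∨ f u < f x := by
  refine convexHull_min (t := {u | u = x ∨ f u < f x}) hs ?_ hu
  refine convex_iff_forall_pos.2 fun y hy z hz α β hα hβ hαβ => ?_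
  have hx : f x = α * f x + β * f x := by rw [← add_mul, hαβ, one_mul]
  have hf : f (α • y + β • z) = α * f y + β * f z := by simp
  have hc : y = x → z = x → α • y + β • z = x := by
    rintro rfl rfl
    rw [← add_smul, hαβ, one_smul]
  rcases hy with hy | hy <;> rcases hz with hz | hz
  · exact Or.inl (hc hy hz)
  all_goals
    right
    rw [hf, hx]
  · subst hy
    linarith [mul_lt_mul_of_pos_left hz hβ]
  · subst hz
    linarith [mul_lt_mul_of_pos_left hy hα]
  · linarith [mul_lt_mul_of_pos_left hy hα, mul_lt_mul_of_pos_left hz hβ]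

/-- Strict rearrangement inequality for strictly increasing sequences. -/
theorem eq_one_or_sum_mul_comp_perm_lt {n : ℕ} {w g : Fin n → ℝ} (hw : StrictMono w)
    (hg : StrictMono g) (σ : Equiv.Perm (Fin n)) :
    σ = 1 ∨ ∑ j, w j * g (σ j) < ∑ j, w j * g j := by
  have hwg : Monovary w g := hw.monotone.monovary hg.monotone
  refine or_iff_not_imp_right.2 fun h => ?_
  rw [hwg.sum_mul_comp_perm_lt_sum_mul_iff, not_not] at h
  refine (Equiv.Perm.monotone_iff σ).1 fun i j hij => ?_
  by_contra! hlt
  exact hij.not_gt (lt_of_le_of_ne (hw.le_iff_le.1 (h (hg hlt))) fun e => by simp [e] at hlt)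

/-- If the weights are strictly increasing and the projections `⟪p, a i⟫` are pairwise
distinct, then `∑ j, w j • a (π j)` (with `π` ordering the projections increasingly) is
the unique maximizer of `x ↦ ⟪p, x⟫` over the WM region; in particular it is an extreme
point of the WM region. -/
theorem stmt3 {d n : ℕ} (w : Fin n → ℝ) (hw0 : ∀ j, 0 ≤ w j)
    (hw1 : ∑ j, w j = 1) (hword : StrictMono w)
    (a : Fin n → EuclideanSpace ℝ (Fin d)) (p : EuclideanSpace ℝ (Fin d))
    (hdist : Function.Injective fun i => ⟪p, a i⟫)
    (π : Equiv.Perm (Fin n))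
    (hπ : StrictMono fun j => ⟪p, a (π j)⟫) :
    (∑ j, w j • a (π j)) ∈ wmRegion w a ∧
    (∀ u ∈ wmRegion w a, ⟪p, u⟫ ≤ ⟪p, ∑ j, w j • a (π j)⟫) ∧
    (∀ u ∈ wmRegion w a, ⟪p, u⟫ = ⟪p, ∑ j, w j • a (π j)⟫ → u = ∑ j, w j • a (π j)) ∧
    (∑ j, w j • a (π j)) ∈ Set.extremePoints ℝ (wmRegion w a) := by
  have hgen : ∀ u ∈ {x | ∃ τ : Equiv.Perm (Fin n), x = ∑ j, w j • a (τ j)},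
      u = ∑ j, w j • a (π j) ∨
        innerₛₗ ℝ p u < innerₛₗ ℝ p (∑ j, w j • a (π j)) := by
    rintro _ ⟨τ, rfl⟩
    rcases eq_one_or_sum_mul_comp_perm_lt hword hπ (π⁻¹ * τ) with h | h
    · rw [inv_mul_eq_one] at h
      exact Or.inl (by rw [h])
    · right
      simpa [inner_sum, inner_smul_right] using h
  have hall : ∀ u ∈ wmRegion w a, u = ∑ j, w j • a (π j) ∨
      ⟪p, u⟫ < ⟪p, ∑ j, w j • a (π j)⟫ :=
    fun u hu => eq_or_lt_of_mem_convexHull (innerₛₗ ℝ p) hgen hu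
  have hmem : ∑ j, w j • a (π j) ∈ wmRegion w a := subset_convexHull ℝ _ ⟨π, rfl⟩
  have hle : ∀ u ∈ wmRegion w a, ⟪p, u⟫ ≤ ⟪p, ∑ j, w j • a (π j)⟫ := fun u hu =>
    (hall u hu).elim (fun h => by rw [h]) le_of_lt
  refine ⟨hmem, hle, fun u hu h => (hall u hu).resolve_right h.not_lt,
    exposedPoints_subset_extremePoints
      ⟨hmem, innerSL ℝ p, fun u hu => ⟨?_, fun h => (hall u hu).resolve_right ?_⟩⟩⟩
  · simpa only [innerSL_apply_apply] using hle u hu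
  · simpa only [innerSL_apply_apply, not_lt] using h
end

section
/- Monotonicity of WM regions: let y^1,…,y^n and z^1,…,z^n be points in ℝ^d with z^k ≤ y^k componentwise for every k, and let w be an ordered weight vector. Then D_w(y^1,…,y^n) ⊆ D_w(z^1,…,z^n) ⊕ ℝ^d_+ and D_w(z^1,…,z^n) ⊆ D_w(y^1,…,y^n) ⊕ ℝ^d_−, where ⊕ denotes Minkowski addition, ℝ^d_+ is the nonnegative orthant and ℝ^d_− the nonpositive orthant. -/
open scoped RealInnerProductSpace Pointwise

/-- If the displacements `a k - b k` all lie in a pointed cone, then the WM region of `a` is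
contained in the Minkowski sum of the WM region of `b` and that cone. -/
theorem wmRegion_subset_add_pointedCone {d n : ℕ} {w : Fin n → ℝ} (hw : ∀ j, 0 ≤ w j)
    {a b : Fin n → EuclideanSpace ℝ (Fin d)} (C : PointedCone ℝ (EuclideanSpace ℝ (Fin d)))
    (hab : ∀ k, a k - b k ∈ C) :
    wmRegion w a ⊆ wmRegion w b + (C : Set (EuclideanSpace ℝ (Fin d))) := by
  refine convexHull_min ?_ ((convex_convexHull ℝ _).add C.convex)
  rintro _ ⟨π, rfl⟩
  refine ⟨∑ j, w j • b (π j), subset_convexHull ℝ _ ⟨π, rfl⟩,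
    ∑ j, w j • (a (π j) - b (π j)), ?_, ?_⟩
  · exact C.sum_mem fun j _ => C.smul_mem (hw j) (hab (π j))
  · simp [smul_sub]

/-- Monotonicity of WM regions: if `z k ≤ y k` componentwise for every `k`, then
`D_w(y) ⊆ D_w(z) ⊕ ℝ^d₊` and `D_w(z) ⊆ D_w(y) ⊕ ℝ^d₋` (Minkowski addition). -/
theorem stmt4 {d n : ℕ} (w : Fin n → ℝ) (hw0 : ∀ j, 0 ≤ w j)
    (hw1 : ∑ j, w j = 1) (hword : Monotone w)
    (y z : Fin n → EuclideanSpace ℝ (Fin d))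
    (hle : ∀ k, ∀ j, z k j ≤ y k j) :
    wmRegion w y ⊆ wmRegion w z + {x : EuclideanSpace ℝ (Fin d) | ∀ j, 0 ≤ x j} ∧
    wmRegion w z ⊆ wmRegion w y + {x : EuclideanSpace ℝ (Fin d) | ∀ j, x j ≤ 0} := by
  constructor
  · let C : PointedCone ℝ (EuclideanSpace ℝ (Fin d)) :=
      { carrier := {x | ∀ j, 0 ≤ x j}
        add_mem' := fun hx hy j => add_nonneg (hx j) (hy j)
        zero_mem' := fun _ => le_rfl
        smul_mem' := fun c _ hx j => mul_nonneg c.2 (hx j) }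
    exact wmRegion_subset_add_pointedCone hw0 C fun k j => sub_nonneg.2 (hle k j)
  · let C : PointedCone ℝ (EuclideanSpace ℝ (Fin d)) :=
      { carrier := {x | ∀ j, x j ≤ 0}
        add_mem' := fun hx hy j => add_nonpos (hx j) (hy j)
        zero_mem' := fun _ => le_rfl
        smul_mem' := fun c _ hx j => mul_nonpos_of_nonneg_of_nonpos c.2 (hx j) }
    exact wmRegion_subset_add_pointedCone hw0 C fun k j => sub_nonpos.2 (hle k j)
end

section
/- Subadditivity of WM regions: let y^1,…,y^n and z^1,…,z^n be points in ℝ^d and let w be an ordered weight vector. Then D_w(y^1+z^1,…,y^n+z^n) ⊆ D_w(y^1,…,y^n) ⊕ D_w(z^1,…,z^n), where ⊕ denotes Minkowski addition. -/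
open scoped RealInnerProductSpace Pointwise

/-- Subadditivity of WM regions: the WM region of the summed samples is contained in the
Minkowski sum of the WM regions of the two samples. -/
theorem stmt5 {d n : ℕ} (w : Fin n → ℝ) (hw0 : ∀ j, 0 ≤ w j)
    (hw1 : ∑ j, w j = 1) (hword : Monotone w)
    (y z : Fin n → EuclideanSpace ℝ (Fin d)) :
    wmRegion w (fun k => y k + z k) ⊆ wmRegion w y + wmRegion w z := by
  refine convexHull_min ?_ ((convex_convexHull ℝ _).add (convex_convexHull ℝ _))
  rintro _ ⟨π, rfl⟩
  simp only [smul_add, Finset.sum_add_distrib]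
  exact Set.add_mem_add (subset_convexHull ℝ _ ⟨π, rfl⟩) (subset_convexHull ℝ _ ⟨π, rfl⟩)
end

section
/- Let U be a nonempty convex compact subset of ℝ^d and b ∈ ℝ. Then ⋂_{a ∈ U} {x ∈ ℝ^d : ⟨a,x⟩ ≥ b} = ⋂_{a ∈ ext U} {x ∈ ℝ^d : ⟨a,x⟩ ≥ b}, where ext U denotes the set of extreme points of U. (The feasible set of the robust linear program is determined by the extreme points of the uncertainty set.) -/
open scoped RealInnerProductSpace

/-- The feasible set of the robust linear program is determined by the extreme points of
the (nonempty convex compact) uncertainty set `U`. -/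
theorem stmt6 {d : ℕ} (U : Set (EuclideanSpace ℝ (Fin d))) (hne : U.Nonempty)
    (hconv : Convex ℝ U) (hcomp : IsCompact U) (b : ℝ) :
    ⋂ a ∈ U, {x : EuclideanSpace ℝ (Fin d) | ⟪a, x⟫ ≥ b} =
      ⋂ a ∈ Set.extremePoints ℝ U, {x : EuclideanSpace ℝ (Fin d) | ⟪a, x⟫ ≥ b} := by
  refine (Set.biInter_subset_biInter_left extremePoints_subset).antisymm fun x hx => ?_
  simp only [Set.mem_iInter, Set.mem_ofPred_eq] at hx ⊢
  have hclosed : IsClosed {a : EuclideanSpace ℝ (Fin d) | b ≤ ⟪a, x⟫} :=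
    isClosed_le continuous_const (by fun_prop)
  have hconvex : Convex ℝ {a : EuclideanSpace ℝ (Fin d) | b ≤ ⟪a, x⟫} :=
    convex_halfSpace_ge
      ⟨fun u v => inner_add_left u v x, fun c u => real_inner_smul_left u x c⟩ b
  intro a ha
  rw [← closure_convexHull_extremePoints hcomp hconv] at ha
  exact closure_minimal (convexHull_min hx hconvex) hclosed ha
end

section
/- Nestedness of WM regions under partial-sum domination: let w and v be ordered weight vectors satisfying Σ_{j=1}^k w_j ≤ Σ_{j=1}^k v_j for every k = 1,…,n. Then for any points a^1,…,a^n ∈ ℝ^d, D_v(a^1,…,a^n) ⊆ D_w(a^1,…,a^n). (Hence the corresponding uncertainty sets are nested and the corresponding robust feasible sets are reversely nested.) -/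
open scoped RealInnerProductSpace Pointwise

/-- Abel summation inequality: a nonnegative antitone weighting of a sequence with nonpositive
partial sums has nonpositive total. -/
theorem sum_mul_nonpos_of_antitone_of_sum_Iic_nonpos {n : ℕ} (b u : Fin n → ℝ)
    (hb : Antitone b) (hb0 : ∀ j, 0 ≤ b j) (hu : ∀ k, ∑ j ∈ Finset.Iic k, u j ≤ 0) :
    ∑ j, b j * u j ≤ 0 := by
  induction n with
  | zero => simp
  | succ n ih =>
    have hrest := ih (fun j => b j.castSucc - b (Fin.last n)) (fun j => u j.castSucc)
      (fun i j hij => sub_le_sub_right (hb (Fin.castSucc_le_castSucc_iff.mpr hij)) _)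
      (fun j => sub_nonneg.mpr (hb (Fin.le_last _)))
      (fun k => by
        have h := hu k.castSucc
        rwa [← Fin.map_castSuccEmb_Iic, Finset.sum_map] at h)
    have htotal : ∑ j, u j ≤ 0 := by
      have h := hu (Fin.last n)
      rwa [← Fin.top_eq_last, Finset.Iic_top] at h
    have hlast := mul_nonpos_of_nonneg_of_nonpos (hb0 (Fin.last n)) htotal
    rw [Fin.sum_univ_castSucc, mul_add, Finset.mul_sum] at hlast
    simp only [sub_mul, Finset.sum_sub_distrib] at hrest
    rw [Fin.sum_univ_castSucc]
    linarith

/-- Pairing with a monotone sequence reverses domination of partial sums. -/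
theorem sum_mul_le_sum_mul_of_monotone_of_sum_Iic_le {n : ℕ} (c w v : Fin n → ℝ)
    (hc : Monotone c) (hsum : ∑ j, w j = ∑ j, v j)
    (hdom : ∀ k, ∑ j ∈ Finset.Iic k, w j ≤ ∑ j ∈ Finset.Iic k, v j) :
    ∑ j, c j * v j ≤ ∑ j, c j * w j := by
  have h := sum_mul_nonpos_of_antitone_of_sum_Iic_nonpos (fun j => (∑ i, |c i|) - c j)
    (fun j => w j - v j) (fun i j hij => sub_le_sub_left (hc hij) _)
    (fun j => sub_nonneg.mpr ((le_abs_self _).trans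
      (Finset.single_le_sum (f := fun i => |c i|) (fun i _ => abs_nonneg _) (Finset.mem_univ j))))
    (fun k => by
      rw [Finset.sum_sub_distrib]
      exact sub_nonpos.mpr (hdom k))
  simp only [sub_mul, mul_sub, Finset.sum_sub_distrib, ← Finset.mul_sum, hsum] at h
  linarith

/-- Nestedness of WM regions under partial-sum domination: if the ordered weight vectors
`w` and `v` satisfy `∑_{j ≤ k} w j ≤ ∑_{j ≤ k} v j` for every `k`, then
`D_v(a) ⊆ D_w(a)`. -/
theorem stmt11 {d n : ℕ} (w v : Fin n → ℝ)
    (hw0 : ∀ j, 0 ≤ w j) (hw1 : ∑ j, w j = 1) (hword : Monotone w)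
    (hv0 : ∀ j, 0 ≤ v j) (hv1 : ∑ j, v j = 1) (hvord : Monotone v)
    (hdom : ∀ k : Fin n, ∑ j ∈ Finset.Iic k, w j ≤ ∑ j ∈ Finset.Iic k, v j)
    (a : Fin n → EuclideanSpace ℝ (Fin d)) :
    wmRegion v a ⊆ wmRegion w a := by
  refine convexHull_min ?_ (convex_convexHull ℝ _)
  rintro x ⟨π, rfl⟩
  by_contra hx
  have hfin : {x | ∃ π : Equiv.Perm (Fin n), x = ∑ j, w j • a (π j)}.Finite :=
    (Set.finite_range fun π : Equiv.Perm (Fin n) => ∑ j, w j • a (π j)).subset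
      (by rintro x ⟨π, rfl⟩; exact ⟨π, rfl⟩)
  obtain ⟨f, r, hf, hr⟩ := geometric_hahn_banach_closed_point
    (convex_convexHull ℝ _) (hfin.isClosed_convexHull ℝ) hx
  set c : Fin n → ℝ := fun j => f (a j)
  set σ := Tuple.sort c
  have hmono : Monotone (c ∘ σ) := Tuple.monotone_sort c
  have hsorted := hf _ (subset_convexHull ℝ _ ⟨σ, rfl⟩)
  have hrearr := (hmono.monovary hvord).sum_comp_perm_mul_le_sum_mul (σ := π.trans σ.symm)
  have hpair := sum_mul_le_sum_mul_of_monotone_of_sum_Iic_le (c ∘ σ) w v hmono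
    (hw1.trans hv1.symm) hdom
  simp only [map_sum, map_smul, smul_eq_mul] at hsorted hr
  simp only [Function.comp_apply, Equiv.trans_apply, Equiv.apply_symm_apply, c,
    mul_comm (f _)] at hrearr hpair
  linarith
end

section
/- Lipschitz continuity of WM regions in the data: let a^1,…,a^n and ā^1,…,ā^n be points in ℝ^d and let w be a weight vector. Then the Hausdorff distance between the WM regions satisfies d_H( D_w(a^1,…,a^n), D_w(ā^1,…,ā^n) ) ≤ max_{1 ≤ i ≤ n} ‖a^i − ā^i‖. -/
open scoped RealInnerProductSpace Pointwise

/-- Every point of a WM region lies within `r` of the WM region of any sample whose points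
are pointwise within `r` of the original ones. -/
theorem exists_mem_wmRegion_dist_le {d n : ℕ} {w : Fin n → ℝ} (hw0 : ∀ j, 0 ≤ w j)
    (hw1 : ∑ j, w j = 1) {a b : Fin n → EuclideanSpace ℝ (Fin d)} {r : ℝ}
    (h : ∀ i, ‖a i - b i‖ ≤ r) {x : EuclideanSpace ℝ (Fin d)} (hx : x ∈ wmRegion w a) :
    ∃ y ∈ wmRegion w b, dist x y ≤ r := by
  have hconv : Convex ℝ (wmRegion w b + Metric.closedBall 0 r) :=
    (convex_convexHull ℝ _).add (convex_closedBall 0 r)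
  have hsub : wmRegion w a ⊆ wmRegion w b + Metric.closedBall 0 r := by
    refine convexHull_min ?_ hconv
    rintro _ ⟨π, rfl⟩
    refine ⟨∑ j, w j • b (π j), subset_convexHull ℝ _ ⟨π, rfl⟩,
      ∑ j, w j • (a (π j) - b (π j)), ?_, ?_⟩
    · rw [mem_closedBall_zero_iff]
      calc ‖∑ j, w j • (a (π j) - b (π j))‖ ≤ ∑ j, w j * r := by
            refine norm_sum_le_of_le _ fun j _ => ?_
            rw [norm_smul, Real.norm_of_nonneg (hw0 j)]
            exact mul_le_mul_of_nonneg_left (h _) (hw0 j)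
        _ = r := by rw [← Finset.sum_mul, hw1, one_mul]
    · simp [smul_sub]
  obtain ⟨y, hy, z, hz, rfl⟩ := hsub hx
  exact ⟨y, hy, by simpa [dist_eq_norm] using hz⟩

/-- Lipschitz continuity of WM regions in the data: the Hausdorff distance between the
WM regions of two samples is at most the maximal pointwise distance of the samples. -/
theorem stmt14 {d n : ℕ} (w : Fin n → ℝ) (hw0 : ∀ j, 0 ≤ w j)
    (hw1 : ∑ j, w j = 1)
    (a abar : Fin n → EuclideanSpace ℝ (Fin d)) :
    Metric.hausdorffDist (wmRegion w a) (wmRegion w abar) ≤ ⨆ i, ‖a i - abar i‖ := by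
  have h : ∀ i, ‖a i - abar i‖ ≤ ⨆ i, ‖a i - abar i‖ :=
    le_ciSup (Set.finite_range fun i => ‖a i - abar i‖).bddAbove
  refine Metric.hausdorffDist_le_of_mem_dist (Real.iSup_nonneg fun i => norm_nonneg _)
    (fun x hx => exists_mem_wmRegion_dist_le hw0 hw1 h hx)
    (fun x hx => exists_mem_wmRegion_dist_le hw0 hw1 (fun i => ?_) hx)
  rw [norm_sub_rev]
  exact h i
end

section
/- Correctness and optimality of the geometric algorithm's solution: let U ⊆ ℝ^d be nonempty, let b > 0, c ∈ ℝ^d, and suppose there are a vector n ∈ ℝ^d and a number d_* > 0 such that ⟨n, a⟩ ≥ d_* for every a ∈ U (n and d_* describe a supporting facet of U visible from the origin), and suppose there exists λ > 0 with λc ∈ U and ⟨n, λc⟩ = d_* (the ray through c intersects this facet inside U). Then x* = (b/d_*) n satisfies ⟨a, x*⟩ ≥ b for every a ∈ U, and for every x ∈ ℝ^d satisfying ⟨a, x⟩ ≥ b for all a ∈ U one has ⟨c, x*⟩ ≤ ⟨c, x⟩; i.e. x* is an optimal solution of the robust linear program min ⟨c,x⟩ subject to ⟨a,x⟩ ≥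 b for all a ∈ U. -/
open scoped RealInnerProductSpace

/-- Correctness and optimality of the geometric algorithm's solution: if `nrm, dstar`
describe a supporting halfspace of `U` (with `dstar > 0`) and the ray through `c` meets
the corresponding facet inside `U` at `lam • c`, then `x* = (b / dstar) • nrm` is
feasible for the robust LP and optimal for the cost `c`. -/
theorem stmt16 {d : ℕ} (U : Set (EuclideanSpace ℝ (Fin d))) (hne : U.Nonempty)
    (b : ℝ) (hb : 0 < b) (c nrm : EuclideanSpace ℝ (Fin d))
    (dstar : ℝ) (hdstar : 0 < dstar)
    (hsupp : ∀ a ∈ U, dstar ≤ ⟪nrm, a⟫)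
    (lam : ℝ) (hlam : 0 < lam) (hmem : lam • c ∈ U)
    (hface : ⟪nrm, lam • c⟫ = dstar) :
    (∀ a ∈ U, ⟪a, (b / dstar) • nrm⟫ ≥ b) ∧
    ∀ x : EuclideanSpace ℝ (Fin d),
      (∀ a ∈ U, ⟪a, x⟫ ≥ b) → ⟪c, (b / dstar) • nrm⟫ ≤ ⟪c, x⟫ := by
  constructor
  · intro a ha
    rw [real_inner_smul_right, real_inner_comm, ge_iff_le]
    calc b = b / dstar * dstar := (div_mul_cancel₀ b hdstar.ne').symm
      _ ≤ b / dstar * ⟪nrm, a⟫ := mul_le_mul_of_nonneg_left (hsupp a ha) (by positivity)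
  · intro x hx
    have hxc : b ≤ lam * ⟪c, x⟫ := by
      simpa only [real_inner_smul_left] using hx _ hmem
    rw [real_inner_smul_right] at hface
    refine le_of_mul_le_mul_left ?_ hlam
    calc lam * ⟪c, (b / dstar) • nrm⟫ = b / dstar * (lam * ⟪nrm, c⟫) := by
          rw [real_inner_smul_right, real_inner_comm]; ring
      _ = b := by rw [hface, div_mul_cancel₀ b hdstar.ne']
      _ ≤ lam * ⟪c, x⟫ := hxc
end
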